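/- Let μ̂ be a Ĝ-invariant ergodic Borel probability measure on ([0,1)∖ℚ) × [0,1) such that μ̂(∂R) = 0 for every open rectangle R = (a,b)×(c,d), and let μ := μ̂∘p₁⁻¹ be its projection to the first coordinate. Then for μ-a.e. irrational x ∈ [0,1) and for all real numbers a < b and c < d: lim_{n→∞} (1/n)·#{k ∈ {0,1,…,n−1} : (T_k(x), V_k(x)) ∈ (a,b)×(c,d)} = μ̂((a,b)×(c,d)). -/

import Mathlib

open MeasureTheory Filter Set Topology

open scoped ENNReal Classical

namespace Paper

variable {E : Type*}

/-- Two-sided shift space over alphabet `E` with incidence matrix `A`. -/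
abbrev EA (A : E → E → Bool) : Type _ :=
  {ω : ℤ → E // ∀ n : ℤ, A (ω n) (ω (n + 1)) = true}

/-- One-sided shift space over alphabet `E` with incidence matrix `A`. -/
abbrev EAplus (A : E → E → Bool) : Type _ :=
  {ω : ℕ → E // ∀ n : ℕ, A (ω n) (ω (n + 1)) = true}

/-- A finite word is `A`-admissible if consecutive letters are linked by `A`. -/
def IsAdmissibleList (A : E → E → Bool) : List E → Prop :=
  List.Chain' (fun c d => A c d = true)

/-- The incidence matrix `A` is finitely irreducible. -/
def FinitelyIrreducible (A : E → E → Bool) : Prop :=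
  ∃ Λ : Finset (List E), (∀ γ ∈ Λ, IsAdmissibleList A γ) ∧
    ∀ a b : E, ∃ γ ∈ Λ, IsAdmissibleList A (a :: (γ ++ [b]))

/-- The incidence matrix `A` is irreducible. -/
def IrreducibleMat (A : E → E → Bool) : Prop :=
  ∀ a b : E, ∃ w : List E, IsAdmissibleList A (a :: (w ++ [b]))

variable {A : E → E → Bool}

/-- The two-sided shift map. -/
def shift (A : E → E → Bool) (ω : EA A) : EA A :=
  ⟨fun n => ω.1 (n + 1), fun n => ω.2 (n + 1)⟩

/-- The one-sided shift map. -/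
def shiftPlus (A : E → E → Bool) (ω : EAplus A) : EAplus A :=
  ⟨fun n => ω.1 (n + 1), fun n => ω.2 (n + 1)⟩

/-- Canonical projection from the two-sided to the one-sided shift space:
`π₁(τ) = τ|₀^{+∞}`. -/
def proj1 (A : E → E → Bool) (τ : EA A) : EAplus A :=
  ⟨fun n => τ.1 (n : ℤ), fun n => by simpa using τ.2 (n : ℤ)⟩

/-- `ω` and `τ` agree on all coordinates `k` with `|k| ≤ n`. -/
def agreeTwo (ω τ : EA A) (n : ℕ) : Prop :=
  ∀ k : ℤ, |k| ≤ (n : ℤ) → ω.1 k = τ.1 k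

/-- `ω` and `τ` agree on all coordinates `0 ≤ k ≤ n`. -/
def agreePlus (ω τ : EAplus A) (n : ℕ) : Prop :=
  ∀ k : ℕ, k ≤ n → ω.1 k = τ.1 k

/-- The metric `d_β` on the two-sided shift space:
`d_β(ω,τ) = exp (-β * max{n ≥ -1 : ω and τ agree up to n})`. -/
noncomputable def dist2 (A : E → E → Bool) (β : ℝ) (ω τ : EA A) : ℝ :=
  ⨅ n : ℕ, if agreeTwo ω τ n then Real.exp (-β * n) else Real.exp β

/-- The metric `d_β` on the one-sided shift space. -/
noncomputable def dist1 (A : E → E → Bool) (β : ℝ) (ω τ : EAplus A) : ℝ :=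
  ⨅ n : ℕ, if agreePlus ω τ n then Real.exp (-β * n) else Real.exp β

/-- `ψ` is locally Hölder continuous with exponent `β` and constant `C`. -/
def LocHolderTwo (A : E → E → Bool) (β C : ℝ) (ψ : EA A → ℝ) : Prop :=
  ∀ ω τ : EA A, ω.1 0 = τ.1 0 → ∀ n : ℕ, agreeTwo ω τ n →
    |ψ ω - ψ τ| ≤ C * Real.exp (-β * n)

/-- `ψ` is locally Hölder continuous (for some exponent and constant). -/
def LocallyHolderTwo (A : E → E → Bool) (ψ : EA A → ℝ) : Prop :=
  ∃ β C : ℝ, 0 < β ∧ 0 < C ∧ LocHolderTwo A β C ψ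

/-- One-sided local Hölder continuity with given exponent and constant. -/
def LocHolderPlus (A : E → E → Bool) (β C : ℝ) (ψ : EAplus A → ℝ) : Prop :=
  ∀ ω τ : EAplus A, ω.1 0 = τ.1 0 → ∀ n : ℕ, agreePlus ω τ n →
    |ψ ω - ψ τ| ≤ C * Real.exp (-β * n)

def LocallyHolderPlus (A : E → E → Bool) (ψ : EAplus A → ℝ) : Prop :=
  ∃ β C : ℝ, 0 < β ∧ 0 < C ∧ LocHolderPlus A β C ψ

/-- Birkhoff sum `S_n ψ` for the two-sided shift. -/
noncomputable def birk (A : E → E → Bool) (ψ : EA A → ℝ) (n : ℕ) (ω : EA A) : ℝ :=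
  ∑ j ∈ Finset.range n, ψ ((shift A)^[j] ω)

/-- Birkhoff sum `S_n ψ` for the one-sided shift. -/
noncomputable def birkPlus (A : E → E → Bool) (ψ : EAplus A → ℝ) (n : ℕ) (ω : EAplus A) : ℝ :=
  ∑ j ∈ Finset.range n, ψ ((shiftPlus A)^[j] ω)

/-- The cylinder in `EA A` fixing coordinates `0,…,|w|-1` to the word `w`. -/
def cylList (A : E → E → Bool) (w : List E) : Set (EA A) :=
  {τ | ∀ k : Fin w.length, τ.1 ((k : ℕ) : ℤ) = w.get k}

/-- The cylinder in `EAplus A` fixing coordinates `0,…,|w|-1` to the word `w`. -/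
def cylListPlus (A : E → E → Bool) (w : List E) : Set (EAplus A) :=
  {τ | ∀ k : Fin w.length, τ.1 (k : ℕ) = w.get k}

/-- Logarithm `ℝ≥0∞ → EReal`, with `log 0 = ⊥` and `log ⊤ = ⊤`. -/
noncomputable def elog (x : ℝ≥0∞) : EReal :=
  if x = 0 then ⊥ else if x = ⊤ then ⊤ else ((Real.log x.toReal : ℝ) : EReal)

/-- Partition function `Σ_{|w|=n, w admissible} exp (sup S_nψ|_{[w]})`
(in `ℝ≥0∞`; the supremum of `exp ∘ S_nψ` over the cylinder equals
`exp (sup S_nψ)`, with the empty supremum equal to `0 = e^{-∞}`). -/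
noncomputable def partFn (A : E → E → Bool) (ψ : EA A → ℝ) (n : ℕ) : ℝ≥0∞ :=
  ∑' w : {w : List E // w.length = n ∧ IsAdmissibleList A w},
    ⨆ τ : cylList A w.1, ENNReal.ofReal (Real.exp (birk A ψ n τ.1))

/-- Topological pressure of `ψ` on the two-sided shift space: the limit (here:
`limsup`, the limit exists by subadditivity) of `(1/n) log` of partition functions. -/
noncomputable def pressure (A : E → E → Bool) (ψ : EA A → ℝ) : EReal :=
  Filter.limsup (fun n : ℕ => (((n : ℝ)⁻¹ : ℝ) : EReal) * elog (partFn A ψ n)) Filter.atTop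

noncomputable def partFnPlus (A : E → E → Bool) (ψ : EAplus A → ℝ) (n : ℕ) : ℝ≥0∞ :=
  ∑' w : {w : List E // w.length = n ∧ IsAdmissibleList A w},
    ⨆ τ : cylListPlus A w.1, ENNReal.ofReal (Real.exp (birkPlus A ψ n τ.1))

/-- Topological pressure on the one-sided shift space. -/
noncomputable def pressurePlus (A : E → E → Bool) (ψ : EAplus A → ℝ) : EReal :=
  Filter.limsup (fun n : ℕ => (((n : ℝ)⁻¹ : ℝ) : EReal) * elog (partFnPlus A ψ n)) Filter.atTop

/-- The cylinder `[e] = {ω : ω₀ = e}`. -/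
def cylE (A : E → E → Bool) (e : E) : Set (EA A) := {τ | τ.1 0 = e}

/-- `ψ` is summable: `Σ_{e∈E} exp (sup ψ|_{[e]}) < +∞`. -/
def SummablePot (A : E → E → Bool) (ψ : EA A → ℝ) : Prop :=
  (∑' e : E, ⨆ τ : cylE A e, ENNReal.ofReal (Real.exp (ψ τ.1))) ≠ ⊤

/-- The cylinder `[ω|₀^{n-1}]`. -/
def cylOf (A : E → E → Bool) (ω : EA A) (n : ℕ) : Set (EA A) :=
  {τ | ∀ k : ℕ, k < n → τ.1 (k : ℤ) = ω.1 (k : ℤ)}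

/-- `μ` is a Gibbs state of `ψ`: it is a `σ`-invariant Borel probability measure and
there are `C ≥ 1`, `P ∈ ℝ` with
`C⁻¹ ≤ μ([ω|₀^{n-1}]) / exp (S_nψ(ω) - Pn) ≤ C` for all `n ≥ 1`, `ω ∈ E_A`. -/
def IsGibbs [MeasurableSpace E] (A : E → E → Bool) (ψ : EA A → ℝ)
    (μ : Measure (EA A)) : Prop :=
  IsProbabilityMeasure μ ∧ μ.map (shift A) = μ ∧
    ∃ C P : ℝ, 1 ≤ C ∧ ∀ n : ℕ, 1 ≤ n → ∀ ω : EA A,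
      ENNReal.ofReal (C⁻¹ * Real.exp (birk A ψ n ω - P * n)) ≤ μ (cylOf A ω n) ∧
      μ (cylOf A ω n) ≤ ENNReal.ofReal (C * Real.exp (birk A ψ n ω - P * n))

/-- A (global) system of conditional measures of `μ` with respect to the partition
of `E_A` into the fibers of `π₁ : E_A → E_A^+`. -/
def IsCondSystem [MeasurableSpace E] (A : E → E → Bool) (μ : Measure (EA A))
    (ν : EAplus A → Measure (EA A)) : Prop :=
  (∀ ω, IsProbabilityMeasure (ν ω)) ∧
  (∀ ω : EAplus A, ν ω {τ : EA A | proj1 A τ = ω} = 1) ∧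
  (∀ s : Set (EA A), MeasurableSet s → μ s = ∫⁻ ω, ν ω s ∂(μ.map (proj1 A)))

/-- The truncation `τ|_{-n}^{+∞}` of a two-sided sequence, as a one-sided sequence. -/
def tail (A : E → E → Bool) (τ : EA A) (n : ℕ) : EAplus A :=
  ⟨fun k => τ.1 ((k : ℤ) - (n : ℤ)), fun k => by
    have h := τ.2 ((k : ℤ) - (n : ℤ))
    have e : (((k + 1 : ℕ) : ℤ)) - (n : ℤ) = ((k : ℤ) - (n : ℤ)) + 1 := by push_cast; ring
    show A (τ.1 ((k : ℤ) - (n : ℤ))) (τ.1 (((k + 1 : ℕ) : ℤ) - (n : ℤ))) = true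
    rw [e]; exact h⟩

/-- The concatenation `eω` of a letter `e` with `ω ∈ E_A^+` (given `A e ω₀ = 1`). -/
def cons (A : E → E → Bool) (e : E) (ω : EAplus A) (h : A e (ω.1 0) = true) : EAplus A :=
  ⟨fun k => Nat.rec (motive := fun _ => E) e (fun m _ => ω.1 m) k, fun k => by
    cases k with
    | zero => exact h
    | succ m => exact ω.2 m⟩

variable {Y : Type*}

/-- `T_τ^n = T_{τ|_{-1}^{+∞}} ∘ T_{τ|_{-2}^{+∞}} ∘ … ∘ T_{τ|_{-n}^{+∞}}`. -/
def Tcomp (A : E → E → Bool) (T : EAplus A → Y → Y) (τ : EA A) : ℕ → Y → Y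
  | 0 => id
  | n + 1 => Tcomp A T τ n ∘ T (tail A τ (n + 1))

/-- `T_η^m = T_{σ^{m-1}η} ∘ … ∘ T_{ση} ∘ T_η` for `η ∈ E_A^+`. -/
def TcompPlus (A : E → E → Bool) (T : EAplus A → Y → Y) : EAplus A → ℕ → Y → Y
  | _, 0 => id
  | η, m + 1 => TcompPlus A T (shiftPlus A η) m ∘ T η



/-! ### Restricted pressure and past cylinders -/

/-- Partition function of `ψ` restricted to the subshift `F_A ⊆ E_A` over a finite
subalphabet `F`. -/
noncomputable def partFnF (A : E → E → Bool) (F : Finset E) (ψ : EA A → ℝ) (n : ℕ) : ℝ≥0∞ :=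
  ∑' w : {w : List E // w.length = n ∧ IsAdmissibleList A w ∧ ∀ e ∈ w, e ∈ F},
    ⨆ τ : ↥(cylList A w.1 ∩ {τ : EA A | ∀ k : ℤ, τ.1 k ∈ F}),
      ENNReal.ofReal (Real.exp (birk A ψ n τ.1))

/-- Topological pressure `P_F(ψ)` of `ψ|_{F_A}` with respect to the shift on the
subshift over the finite subalphabet `F` (equal to `⊥` if `F_A = ∅`). -/
noncomputable def pressureF (A : E → E → Bool) (F : Finset E) (ψ : EA A → ℝ) : EReal :=
  Filter.limsup (fun n : ℕ => (((n : ℝ)⁻¹ : ℝ) : EReal) * elog (partFnF A F ψ n)) Filter.atTop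

/-- The matrix `A` restricted to `F × F` is irreducible. -/
def IrredOn (A : E → E → Bool) (F : Finset E) : Prop :=
  ∀ a ∈ F, ∀ b ∈ F, ∃ w : List E, (∀ e ∈ w, e ∈ F) ∧ IsAdmissibleList A (a :: (w ++ [b]))

/-- The cylinder `[τω] ⊆ E_A`: sequences whose nonnegative part is `ω` and whose
coordinates `-n ≤ k ≤ -1` are given by the word `w` (with `w.get i` at coordinate
`i - n`, `n = |w|`). -/
def cylPast (A : E → E → Bool) (w : List E) (ω : EAplus A) : Set (EA A) :=
  {γ | proj1 A γ = ω ∧ ∀ k : Fin w.length, γ.1 (((k : ℕ) : ℤ) - (w.length : ℤ)) = w.get k}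

/-! ### Conformal skew product Smale endomorphisms -/

/-- A conformal skew product Smale endomorphism, i.e. a skew product Smale
endomorphism satisfying conditions (a)–(g) of Section 5 of the paper, with fibers
in `ℝ^d`. The projection `π̂₂` is part of the data, characterized by the field `hpi2`. -/
structure CSS [MeasurableSpace E] (A : E → E → Bool) (d : ℕ) where
  /-- The fiber sets `Y_ω`. -/
  Yset : EAplus A → Set (EuclideanSpace ℝ (Fin d))
  /-- The open neighborhoods `Y_ω^*` of the sets `Y_ω`. -/
  Ystar : EAplus A → Set (EuclideanSpace ℝ (Fin d))
  /-- The fiber maps `T_ω` (together with their conformal extensions to `Y_ω^*`). -/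
  T : EAplus A → EuclideanSpace ℝ (Fin d) → EuclideanSpace ℝ (Fin d)
  /-- The projection `π̂₂ : E_A → ℝ^d`. -/
  pi2 : EA A → EuclideanSpace ℝ (Fin d)
  lam : ℝ
  Hc : ℝ
  alpha : ℝ
  hlam : 1 < lam
  hHc : 0 < Hc
  halpha : 0 < alpha
  hYclosed : ∀ ω, IsClosed (Yset ω)
  hYbdd : Bornology.IsBounded (⋃ ω, Yset ω)
  hYreg : ∀ ω, Yset ω = closure (interior (Yset ω))
  hstar_open : ∀ ω, IsOpen (Ystar ω)
  hstar_conn : ∀ ω, IsConnected (Ystar ω)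
  hstar_bdd : ∀ ω, Bornology.IsBounded (Ystar ω)
  hYsub : ∀ ω, Yset ω ⊆ Ystar ω
  hmapsY : ∀ ω, Set.MapsTo (T ω) (Yset ω) (Yset (shiftPlus A ω))
  hmapsStar : ∀ ω, Set.MapsTo (T ω) (Ystar ω) (Ystar (shiftPlus A ω))
  hinj : ∀ ω, Set.InjOn (T ω) (Ystar ω)
  hC1 : ∀ ω, ContDiffOn ℝ 1 (T ω) (Ystar ω)
  hconf : ∀ ω, ∀ y ∈ Ystar ω, ConformalAt (T ω) y
  hcontr : ∀ ω, ∀ y ∈ Ystar ω, ∀ z ∈ Ystar ω, dist (T ω y) (T ω z) ≤ lam⁻¹ * dist y z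
  hdistort : ∀ ω, ∀ y ∈ Ystar ω, ∀ z ∈ Ystar ω,
      |Real.log ‖fderiv ℝ (T ω) y‖ - Real.log ‖fderiv ℝ (T ω) z‖| ≤ Hc * ‖y - z‖ ^ alpha
  hpi2 : ∀ τ : EA A,
      (⋂ n : ℕ, closure (Tcomp A T τ (n + 1) '' Yset (tail A τ (n + 1)))) = {pi2 τ}
  hHolderDer : ∃ β C : ℝ, 0 < β ∧ 0 < C ∧ ∀ τ τ' : EA A,
      |Real.log ‖fderiv ℝ (T (proj1 A τ)) (pi2 τ)‖ -
        Real.log ‖fderiv ℝ (T (proj1 A τ')) (pi2 τ')‖| ≤ C * dist2 A β τ τ'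
  hOSC : ∀ (ω : EAplus A) (a b : E) (ha : A a (ω.1 0) = true) (hb : A b (ω.1 0) = true),
      a ≠ b →
      Disjoint (T (cons A a ω ha) '' interior (Yset (cons A a ω ha)))
        (T (cons A b ω hb) '' interior (Yset (cons A b ω hb)))
  hbdry : ∃ δ : EAplus A → ℝ, Measurable δ ∧ (∀ ω, 0 < δ ω) ∧
      ∀ ω, ((pi2 '' {τ : EA A | proj1 A τ = ω}) ∩
        (Yset ω \ Metric.cthickening (δ ω) (Yset ω)ᶜ)).Nonempty

namespace CSS

variable [MeasurableSpace E] {d : ℕ}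

/-- The fiber `J_ω = π̂₂([ω])`. -/
def J (S : CSS A d) (ω : EAplus A) : Set (EuclideanSpace ℝ (Fin d)) :=
  S.pi2 '' {τ : EA A | proj1 A τ = ω}

/-- The system is Hölder: the projection `π̂` is Hölder continuous. -/
def IsHolder (S : CSS A d) : Prop :=
  ∃ κ C θ : ℝ, 0 < κ ∧ 0 < C ∧ 0 < θ ∧
    ∀ τ τ' : EA A, dist (S.pi2 τ) (S.pi2 τ') ≤ C * dist2 A κ τ τ' ^ θ

/-- Uniform Geometry Condition: every `Y_ω` contains a ball of a fixed radius `R > 0`. -/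
def UGC (S : CSS A d) : Prop :=
  ∃ R : ℝ, 0 < R ∧ ∀ ω : EAplus A, ∃ ξ, Metric.ball ξ R ⊆ S.Yset ω

/-- The geometric potential `ψ_t ∘ π̂ : τ ↦ -t log |T'_{τ|₀^{+∞}} (π̂₂ τ)|`. -/
noncomputable def geomPot (S : CSS A d) (t : ℝ) : EA A → ℝ :=
  fun τ => -t * Real.log ‖fderiv ℝ (S.T (proj1 A τ)) (S.pi2 τ)‖

/-- The pressure function `t ↦ P(t) = P(ψ_t ∘ π̂)`. -/
noncomputable def P (S : CSS A d) (t : ℝ) : EReal := pressure A (S.geomPot t)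

/-- Bowen's parameter `B_T = inf {t ≥ 0 : P(t) ≤ 0}` (equal to `⊤` if there is no
such `t`). -/
noncomputable def bowen (S : CSS A d) : ℝ≥0∞ :=
  sInf {s : ℝ≥0∞ | ∃ t : ℝ, 0 ≤ t ∧ s = ENNReal.ofReal t ∧ S.P t ≤ 0}

end CSS

/-- `φ_{ω|_n} = φ_{ω_0} ∘ φ_{ω_1} ∘ … ∘ φ_{ω_{n-1}}`. -/
def compPhi {Y : Type*} (A : E → E → Bool) (φ : E → Y → Y) (ω : EAplus A) : ℕ → Y → Y
  | 0 => id
  | n + 1 => compPhi A φ ω n ∘ φ (ω.1 n)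

/-- A conformal graph directed Markov system (GDMS) with vertex set `V`,
countable edge set `E`, and phase space in `ℝ^d`; the coding map `π_S` is part
of the data, characterized by the field `hpiS`. -/
structure GDMS (V : Type*) (E : Type*) (d : ℕ) where
  ivx : E → V
  tvx : E → V
  A : E → E → Bool
  hA : ∀ a b : E, A a b = true → tvx b = ivx a
  X : V → Set (EuclideanSpace ℝ (Fin d))
  W : V → Set (EuclideanSpace ℝ (Fin d))
  φ : E → EuclideanSpace ℝ (Fin d) → EuclideanSpace ℝ (Fin d)
  lam : ℝ
  hlam : lam ∈ Set.Ioo (0 : ℝ) 1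
  hXcpt : ∀ v, IsCompact (X v)
  hXconn : ∀ v, IsConnected (X v)
  hXreg : ∀ v, X v = closure (interior (X v))
  hWopen : ∀ v, IsOpen (W v)
  hWconn : ∀ v, IsConnected (W v)
  hXW : ∀ v, X v ⊆ W v
  hmapsX : ∀ e, Set.MapsTo (φ e) (X (tvx e)) (X (ivx e))
  hmapsW : ∀ e, Set.MapsTo (φ e) (W (tvx e)) (W (ivx e))
  hinj : ∀ e, Set.InjOn (φ e) (W (tvx e))
  hconf : ∀ e, ∀ y ∈ W (tvx e), ConformalAt (φ e) y
  hC1 : ∀ e, ContDiffOn ℝ 1 (φ e) (W (tvx e))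
  hLip : ∀ e, ∀ y ∈ X (tvx e), ∀ z ∈ X (tvx e), dist (φ e y) (φ e z) ≤ lam * dist y z
  piS : EAplus A → EuclideanSpace ℝ (Fin d)
  hpiS : ∀ ω : EAplus A, (⋂ n : ℕ, compPhi A φ ω (n + 1) '' X (tvx (ω.1 n))) = {piS ω}

/-! ### The Gauss map, continued fractions and the natural extension -/

/-- The Gauss (continued fraction) map `G(x) = 1/x - ⌊1/x⌋`, `G 0 = 0`. -/
noncomputable def gauss (x : ℝ) : ℝ := if x = 0 then 0 else Int.fract x⁻¹

/-- The denominators `q_n(x)` of the convergents of the continued fraction expansion,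
via `q₀ = 1`, `q₁ = ⌊1/x⌋` and `q_{n+2} = ⌊1/G^{n+1}(x)⌋ q_{n+1} + q_n`. -/
noncomputable def qden : ℕ → ℝ → ℤ
  | 0, _ => 1
  | 1, x => ⌊x⁻¹⌋
  | (n + 2), x => ⌊(gauss^[n + 1] x)⁻¹⌋ * qden (n + 1) x + qden n x

/-- `V_n(x) = q_{n-1}(x)/q_n(x)`, with `V₀ = 0`. -/
noncomputable def Vpast (n : ℕ) (x : ℝ) : ℝ :=
  if n = 0 then 0 else (qden (n - 1) x : ℝ) / (qden n x : ℝ)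

/-- The natural extension of the Gauss map, `Ĝ(x,y) = (G x, 1/(⌊1/x⌋ + y))`. -/
noncomputable def gaussExt (p : ℝ × ℝ) : ℝ × ℝ :=
  (gauss p.1, ((⌊p.1⁻¹⌋ : ℝ) + p.2)⁻¹)



/-- `ergodicMax T g n x` is the maximum of the Birkhoff sums `S₁ g x, …, S_{n+1} g x`. -/
noncomputable def ergodicMax {α : Type*} (T : α → α) (g : α → ℝ) : ℕ → α → ℝ
  | 0, x => g x
  | n + 1, x => g x + max 0 (ergodicMax T g n (T x))

section Birkhoff

variable {α : Type*} {T : α → α} {g : α → ℝ}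

lemma le_ergodicMax (n : ℕ) (x : α) : g x ≤ ergodicMax T g n x := by
  cases n with
  | zero => exact le_rfl
  | succ n => simp [ergodicMax]

lemma ergodicMax_le_succ (n : ℕ) (x : α) : ergodicMax T g n x ≤ ergodicMax T g (n + 1) x := by
  induction n generalizing x with
  | zero => simp [ergodicMax]
  | succ n ih =>
    rw [ergodicMax, ergodicMax]
    gcongr
    exact ih _

lemma birkhoffSum_succ_le_ergodicMax (n : ℕ) (x : α) :
    birkhoffSum T g (n + 1) x ≤ ergodicMax T g n x := by
  induction n generalizing x with
  | zero => simp [ergodicMax]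
  | succ n ih =>
    rw [birkhoffSum_succ', ergodicMax]
    gcongr
    exact (ih _).trans (le_max_right _ _)

lemma birkhoffSum_sub_const (f : α → ℝ) (c : ℝ) (n : ℕ) (x : α) :
    birkhoffSum T (fun y ↦ f y - c) n x = birkhoffSum T f n x - n * c := by
  simp [birkhoffSum, Finset.sum_sub_distrib]

variable [MeasurableSpace α] {μ : Measure α}

lemma measurable_ergodicMax (hT : Measurable T) (hg : Measurable g) (n : ℕ) :
    Measurable (ergodicMax T g n) := by
  induction n with
  | zero => exact hg
  | succ n ih => exact hg.add (measurable_const.max (ih.comp hT))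

lemma integrable_ergodicMax [IsFiniteMeasure μ] (hT : MeasurePreserving T μ μ)
    (hg : Integrable g μ) (n : ℕ) : Integrable (ergodicMax T g n) μ := by
  induction n with
  | zero => exact hg
  | succ n ih =>
    exact hg.add ((integrable_const (0 : ℝ)).sup (hT.integrable_comp_of_integrable ih))

/-- If `∫ g < 0` then almost every orbit of an ergodic map has Birkhoff sums of `g` bounded
above. -/
lemma ae_bddAbove_birkhoffSum [IsProbabilityMeasure μ] (hT : Ergodic T μ) (hg : Measurable g)
    (hgi : Integrable g μ) (hneg : ∫ x, g x ∂μ < 0) :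
    ∀ᵐ x ∂μ, ∃ M : ℝ, ∀ n, birkhoffSum T g n x ≤ M := by
  set A : Set α := {x | ∀ M : ℕ, ∃ n, (M : ℝ) < ergodicMax T g n x} with hA
  have hAm : MeasurableSet A := by
    have : A = ⋂ M : ℕ, ⋃ n, {x | (M : ℝ) < ergodicMax T g n x} := by ext; simp [hA]
    rw [this]
    exact .iInter fun M ↦ .iUnion fun n ↦
      measurableSet_lt measurable_const (measurable_ergodicMax hT.measurable hg n)
  have hinv : T ⁻¹' A = A := by
    ext x
    constructor
    · intro h M
      obtain ⟨K, hK⟩ := exists_nat_gt (M - g x)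
      obtain ⟨n, hn⟩ := h K
      refine ⟨n + 1, ?_⟩
      rw [ergodicMax]
      linarith [le_max_right 0 (ergodicMax T g n (T x))]
    · intro h M
      obtain ⟨K, hK⟩ := exists_nat_gt (M + g x)
      obtain ⟨n, hn⟩ := h (max K (⌈g x⌉₊))
      refine ⟨n, ?_⟩
      have h1 := hn.trans_le (ergodicMax_le_succ n x)
      rw [ergodicMax] at h1
      push_cast at h1
      have h2 := (max_lt_iff.1 h1)
      by_contra! h3
      have h4 : max 0 (ergodicMax T g n (T x)) ≤ M := max_le (Nat.cast_nonneg M) h3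
      linarith
  rcases hT.ae_empty_or_univ hAm hinv with h0 | h1
  · have : ∀ᵐ x ∂μ, x ∉ A := by
      filter_upwards [h0] with x hx hxA
      exact (hx.mp hxA : x ∈ (∅ : Set α))
    filter_upwards [this] with x hx
    simp only [hA, mem_ofPred_eq, not_forall, not_exists, not_lt] at hx
    obtain ⟨M, hM⟩ := hx
    refine ⟨M, fun n ↦ ?_⟩
    cases n with
    | zero => simp
    | succ n => exact (birkhoffSum_succ_le_ergodicMax n x).trans (hM n)
  · exfalso
    have hF := integrable_ergodicMax hT.toMeasurePreserving hgi
    have hFT : ∀ n, Integrable (fun x ↦ ergodicMax T g n (T x)) μ := fun n ↦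
      hT.toMeasurePreserving.integrable_comp_of_integrable (hF n)
    have hlim : Tendsto (fun n ↦ ∫ x, (ergodicMax T g (n + 1) x - ergodicMax T g n (T x)) ∂μ)
        atTop (𝓝 (∫ x, g x ∂μ)) := by
      refine tendsto_integral_of_dominated_convergence (fun x ↦ |g x| + |g (T x)|)
        (fun n ↦ ((hF (n + 1)).sub (hFT n)).aestronglyMeasurable)
        (hgi.abs.add (hT.toMeasurePreserving.integrable_comp_of_integrable hgi.abs)) ?_ ?_
      · refine fun n ↦ .of_forall fun x ↦ ?_
        have h2 := le_ergodicMax (T := T) (g := g) n (T x)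
        rw [ergodicMax, Real.norm_eq_abs, add_sub_assoc]
        refine (abs_add_le _ _).trans (add_le_add le_rfl ?_)
        rcases le_total 0 (ergodicMax T g n (T x)) with h | h
        · simp [max_eq_right h]
        · rw [max_eq_left h, zero_sub, abs_neg]
          exact abs_le_abs_of_nonpos h h2
      · filter_upwards [h1] with x hx
        have hxA : T x ∈ A := by
          have : x ∈ A := hx.mpr trivial
          rwa [← hinv] at this
        obtain ⟨n, hn⟩ := hxA 0
        refine tendsto_const_nhds.congr' ?_
        filter_upwards [eventually_ge_atTop n] with m hm
        have h3 := monotone_nat_of_le_succ (fun k ↦ ergodicMax_le_succ (T := T) (g := g) k (T x)) hm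
        have h4 : 0 ≤ ergodicMax T g m (T x) := by
          simp only [Nat.cast_zero] at hn
          exact hn.le.trans h3
        rw [ergodicMax, max_eq_right h4]
        ring
    refine absurd hneg (not_lt.2 (ge_of_tendsto' hlim fun n ↦ ?_))
    rw [integral_sub (hF _) (hFT n)]
    have h5 : ∫ x, ergodicMax T g n (T x) ∂μ = ∫ x, ergodicMax T g n x ∂μ := by
      conv_rhs => rw [← hT.map_eq]
      rw [integral_map hT.measurable.aemeasurable]
      exact (measurable_ergodicMax hT.measurable hg n).aestronglyMeasurable
    rw [h5, sub_nonneg]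
    exact integral_mono (hF n) (hF _) (ergodicMax_le_succ n)

lemma ae_eventually_birkhoffSum_div_lt [IsProbabilityMeasure μ] (hT : Ergodic T μ)
    {f : α → ℝ} (hf : Measurable f) (hfi : Integrable f μ) :
    ∀ᵐ x ∂μ, ∀ c > ∫ y, f y ∂μ, ∀ᶠ n : ℕ in atTop, birkhoffSum T f n x / n < c := by
  have key (m : ℕ) : ∀ᵐ x ∂μ, ∃ M : ℝ, ∀ n,
      birkhoffSum T (fun y ↦ f y - (∫ y, f y ∂μ + 1 / ((m : ℝ) + 1))) n x ≤ M := by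
    refine ae_bddAbove_birkhoffSum hT (hf.sub_const _) (hfi.sub (integrable_const _)) ?_
    rw [integral_sub hfi (integrable_const _)]
    have : 0 < 1 / ((m : ℝ) + 1) := Nat.one_div_pos_of_nat
    simpa using this
  filter_upwards [ae_all_iff.2 key] with x hx c hc
  obtain ⟨m, hm⟩ := exists_nat_one_div_lt (sub_pos.2 hc)
  obtain ⟨M, hM⟩ := hx m
  have hlim : Tendsto (fun n : ℕ ↦ M / n + (∫ y, f y ∂μ + 1 / ((m : ℝ) + 1))) atTop
      (𝓝 (0 + (∫ y, f y ∂μ + 1 / ((m : ℝ) + 1)))) :=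
    (tendsto_const_div_atTop_nhds_zero_nat M).add_const _
  filter_upwards [hlim.eventually_lt_const (u := c) (by linarith), eventually_gt_atTop 0]
    with n hn hn0
  refine lt_of_le_of_lt ?_ hn
  have hn0' : (0 : ℝ) < n := by exact_mod_cast hn0
  have := hM n
  rw [birkhoffSum_sub_const] at this
  rw [div_add' _ _ _ hn0'.ne']
  gcongr
  linarith

/-- **Birkhoff's pointwise ergodic theorem** for an ergodic probability-preserving map. -/
theorem ae_tendsto_birkhoffSum_div [IsProbabilityMeasure μ] (hT : Ergodic T μ)
    {f : α → ℝ} (hf : Measurable f) (hfi : Integrable f μ) :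
    ∀ᵐ x ∂μ, Tendsto (fun n : ℕ ↦ birkhoffSum T f n x / n) atTop (𝓝 (∫ y, f y ∂μ)) := by
  filter_upwards [ae_eventually_birkhoffSum_div_lt hT hf hfi,
    ae_eventually_birkhoffSum_div_lt hT hf.neg hfi.neg] with x h1 h2
  refine tendsto_order.2 ⟨fun c hc ↦ ?_, h1⟩
  have h3 := h2 (-c) (by simpa [integral_neg] using hc)
  filter_upwards [h3] with n hn
  have : birkhoffSum T (-f) n x = - birkhoffSum T f n x := by simp [birkhoffSum]
  rw [this, neg_div] at hn
  linarith

end Birkhoff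

section VisitFrequency

/-- The frequency of visits to `R` of the first `n` terms of the sequence `u`. -/
noncomputable def visitFreq {α : Type*} (u : ℕ → α) (R : Set α) (n : ℕ) : ℝ :=
  (∑ k ∈ Finset.range n, R.indicator 1 (u k)) / n

lemma exists_visitFreq_le {α β : Type*} {u : ℕ → α} {v : ℕ → β} {R : Set α} {S : Set β}
    (h : ∀ᶠ k in atTop, u k ∈ R → v k ∈ S) :
    ∃ N : ℕ, ∀ n, visitFreq u R n ≤ visitFreq v S n + N / n := by
  obtain ⟨N, hN⟩ := eventually_atTop.1 h
  refine ⟨N, fun n ↦ ?_⟩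
  rw [visitFreq, visitFreq, ← add_div]
  gcongr
  have hle : ∀ k, R.indicator (1 : α → ℝ) (u k) ≤
      S.indicator (1 : β → ℝ) (v k) + if k < N then 1 else 0 := by
    intro k
    by_cases hk : k < N
    · by_cases h1 : u k ∈ R <;> by_cases h2 : v k ∈ S <;> simp [h1, h2, hk]
    · have := hN k (not_lt.1 hk)
      by_cases h1 : u k ∈ R <;> by_cases h2 : v k ∈ S <;> simp [h1, h2, hk]
      exact absurd (this h1) h2
  refine (Finset.sum_le_sum fun k _ ↦ hle k).trans ?_
  rw [Finset.sum_add_distrib, Finset.sum_boole]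
  gcongr
  refine (Finset.card_le_card (t := Finset.range N) fun k hk ↦ ?_).trans (by simp)
  simpa using (Finset.mem_filter.1 hk).2

lemma eventually_lt_visitFreq {α β : Type*} {u : ℕ → α} {v : ℕ → β} {R : Set α} {S : Set β}
    (h : ∀ᶠ k in atTop, u k ∈ R → v k ∈ S) {l r : ℝ} (hr : r < l)
    (hl : Tendsto (visitFreq u R) atTop (𝓝 l)) : ∀ᶠ n in atTop, r < visitFreq v S n := by
  obtain ⟨N, hN⟩ := exists_visitFreq_le h
  have := hl.sub (tendsto_const_div_atTop_nhds_zero_nat (N : ℝ))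
  filter_upwards [this.eventually_const_lt (by simpa using hr)] with n hn
  linarith [hN n]

lemma eventually_visitFreq_lt {α β : Type*} {u : ℕ → α} {v : ℕ → β} {R : Set α} {S : Set β}
    (h : ∀ᶠ k in atTop, v k ∈ S → u k ∈ R) {l r : ℝ} (hr : l < r)
    (hl : Tendsto (visitFreq u R) atTop (𝓝 l)) : ∀ᶠ n in atTop, visitFreq v S n < r := by
  obtain ⟨N, hN⟩ := exists_visitFreq_le h
  have := hl.add (tendsto_const_div_atTop_nhds_zero_nat (N : ℝ))
  filter_upwards [this.eventually_lt_const (by simpa using hr)] with n hn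
  linarith [hN n]

variable {μ : Measure (ℝ × ℝ)} [IsFiniteMeasure μ] {a b c e r : ℝ}

lemma exists_rat_inner_rectangle (h : r < μ.real (Ioo a b ×ˢ Ioo c e)) :
    ∃ a' b' c' e' : ℚ, a < a' ∧ b' < b ∧ c < c' ∧ e' < e ∧
      r < μ.real (Ioo (a' : ℝ) b' ×ˢ Ioo (c' : ℝ) e') := by
  let s : ℕ → Set (ℝ × ℝ) := fun n ↦ Ioo (a + 1 / ((n : ℝ) + 1)) (b - 1 / ((n : ℝ) + 1)) ×ˢ
    Ioo (c + 1 / ((n : ℝ) + 1)) (e - 1 / ((n : ℝ) + 1))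
  have hs : Monotone s := by
    intro m n hmn
    have := Nat.one_div_le_one_div (α := ℝ) hmn
    exact prod_mono (Ioo_subset_Ioo (by linarith) (by linarith))
      (Ioo_subset_Ioo (by linarith) (by linarith))
  have hU : ⋃ n, s n = Ioo a b ×ˢ Ioo c e := by
    refine subset_antisymm (iUnion_subset fun n ↦ ?_) ?_
    · have : 0 < 1 / ((n : ℝ) + 1) := Nat.one_div_pos_of_nat
      exact prod_mono (Ioo_subset_Ioo (by linarith) (by linarith))
        (Ioo_subset_Ioo (by linarith) (by linarith))
    · rintro ⟨x, y⟩ ⟨⟨h1, h2⟩, h3, h4⟩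
      simp only at h1 h2 h3 h4
      obtain ⟨n, hn⟩ := exists_nat_one_div_lt (K := ℝ)
        (lt_min (lt_min (sub_pos.2 h1) (sub_pos.2 h2)) (lt_min (sub_pos.2 h3) (sub_pos.2 h4)))
      simp only [lt_min_iff] at hn
      refine mem_iUnion.2 ⟨n, ⟨?_, ?_⟩, ?_, ?_⟩ <;> simp only <;> linarith
  have hlim := (ENNReal.tendsto_toReal (measure_ne_top μ _)).comp
    (tendsto_measure_iUnion_atTop (μ := μ) hs)
  rw [hU] at hlim
  obtain ⟨n, hn⟩ := (hlim.eventually_const_lt h).exists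
  have hpos : 0 < 1 / ((n : ℝ) + 1) := Nat.one_div_pos_of_nat
  obtain ⟨a', ha1, ha2⟩ := exists_rat_btwn (lt_add_of_pos_right a hpos)
  obtain ⟨b', hb1, hb2⟩ := exists_rat_btwn (sub_lt_self b hpos)
  obtain ⟨c', hc1, hc2⟩ := exists_rat_btwn (lt_add_of_pos_right c hpos)
  obtain ⟨e', he1, he2⟩ := exists_rat_btwn (sub_lt_self e hpos)
  refine ⟨a', b', c', e', ha1, hb2, hc1, he2, lt_of_lt_of_le hn ?_⟩
  exact measureReal_mono (prod_mono (Ioo_subset_Ioo ha2.le hb1.le) (Ioo_subset_Ioo hc2.le he1.le))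

lemma exists_rat_outer_rectangle (h : μ.real (Icc a b ×ˢ Icc c e) < r) :
    ∃ a' b' c' e' : ℚ, a' < a ∧ b < b' ∧ c' < c ∧ e < e' ∧
      μ.real (Ioo (a' : ℝ) b' ×ˢ Ioo (c' : ℝ) e') < r := by
  let s : ℕ → Set (ℝ × ℝ) := fun n ↦ Ioo (a - 1 / ((n : ℝ) + 1)) (b + 1 / ((n : ℝ) + 1)) ×ˢ
    Ioo (c - 1 / ((n : ℝ) + 1)) (e + 1 / ((n : ℝ) + 1))
  have hs : Antitone s := by
    intro m n hmn
    have := Nat.one_div_le_one_div (α := ℝ) hmn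
    exact prod_mono (Ioo_subset_Ioo (by linarith) (by linarith))
      (Ioo_subset_Ioo (by linarith) (by linarith))
  have hI : ⋂ n, s n = Icc a b ×ˢ Icc c e := by
    refine subset_antisymm ?_ (subset_iInter fun n ↦ ?_)
    · rintro ⟨x, y⟩ h
      have h' (n : ℕ) := mem_iInter.1 h n
      simp only [s, mem_prod, mem_Ioo] at h'
      refine ⟨⟨?_, ?_⟩, ?_, ?_⟩ <;> simp only <;> by_contra! hlt <;>
        obtain ⟨n, hn⟩ := exists_nat_one_div_lt (sub_pos.2 hlt) <;>
        linarith [(h' n).1.1, (h' n).1.2, (h' n).2.1, (h' n).2.2]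
    · have : 0 < 1 / ((n : ℝ) + 1) := Nat.one_div_pos_of_nat
      exact prod_mono (Icc_subset_Ioo (by linarith) (by linarith))
        (Icc_subset_Ioo (by linarith) (by linarith))
  have hlim := (ENNReal.tendsto_toReal (measure_ne_top μ _)).comp
    (tendsto_measure_iInter_atTop (μ := μ)
      (fun n ↦ (measurableSet_Ioo.prod measurableSet_Ioo).nullMeasurableSet) hs
      ⟨0, measure_ne_top μ _⟩)
  rw [hI] at hlim
  obtain ⟨n, hn⟩ := (hlim.eventually_lt_const h).exists
  have hpos : 0 < 1 / ((n : ℝ) + 1) := Nat.one_div_pos_of_nat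
  obtain ⟨a', ha1, ha2⟩ := exists_rat_btwn (sub_lt_self a hpos)
  obtain ⟨b', hb1, hb2⟩ := exists_rat_btwn (lt_add_of_pos_right b hpos)
  obtain ⟨c', hc1, hc2⟩ := exists_rat_btwn (sub_lt_self c hpos)
  obtain ⟨e', he1, he2⟩ := exists_rat_btwn (lt_add_of_pos_right e hpos)
  refine ⟨a', b', c', e', ha2, hb1, hc2, he1, lt_of_le_of_lt ?_ hn⟩
  exact measureReal_mono (prod_mono (Ioo_subset_Ioo ha1.le hb2.le) (Ioo_subset_Ioo hc1.le he2.le))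

/-- Convergence of the visit frequencies to rational rectangles passes to all rectangles with null
boundary, also for a sequence whose second coordinate is asymptotic to the given one. -/
lemma tendsto_visitFreq_rectangle {t u v : ℕ → ℝ}
    (huv : Tendsto (fun k ↦ u k - v k) atTop (𝓝 0))
    (h : ∀ a b c e : ℚ, Tendsto (visitFreq (fun k ↦ (t k, u k)) (Ioo (a : ℝ) b ×ˢ Ioo (c : ℝ) e))
      atTop (𝓝 (μ.real (Ioo (a : ℝ) b ×ˢ Ioo (c : ℝ) e))))
    (hab : a < b) (hce : c < e) (hbd : μ (frontier (Ioo a b ×ˢ Ioo c e)) = 0) :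
    Tendsto (visitFreq (fun k ↦ (t k, v k)) (Ioo a b ×ˢ Ioo c e))
      atTop (𝓝 (μ.real (Ioo a b ×ˢ Ioo c e))) := by
  have hclose : ∀ δ > 0, ∀ᶠ k in atTop, |u k - v k| < δ := fun δ hδ ↦ by
    simpa [Real.dist_eq] using Metric.tendsto_nhds.1 huv δ hδ
  refine tendsto_order.2 ⟨fun r hr ↦ ?_, fun r hr ↦ ?_⟩
  · obtain ⟨a', b', c', e', ha, hb, hc, he, hr'⟩ := exists_rat_inner_rectangle hr
    refine eventually_lt_visitFreq ?_ hr' (h a' b' c' e')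
    filter_upwards [hclose _ (sub_pos.2 hc), hclose _ (sub_pos.2 he)] with k h1 h2
    rintro ⟨⟨h3, h4⟩, h5, h6⟩
    rw [abs_lt] at h1 h2
    refine ⟨⟨?_, ?_⟩, ?_, ?_⟩ <;> simp only at * <;> linarith
  · have hcl : μ.real (Icc a b ×ˢ Icc c e) < r := by
      rwa [← closure_Ioo hab.ne, ← closure_Ioo hce.ne, ← closure_prod_eq, measureReal_def,
        measure_closure_of_null_frontier hbd]
    obtain ⟨a', b', c', e', ha, hb, hc, he, hr'⟩ := exists_rat_outer_rectangle hcl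
    refine eventually_visitFreq_lt ?_ hr' (h a' b' c' e')
    filter_upwards [hclose _ (sub_pos.2 hc), hclose _ (sub_pos.2 he)] with k h1 h2
    rintro ⟨⟨h3, h4⟩, h5, h6⟩
    rw [abs_lt] at h1 h2
    refine ⟨⟨?_, ?_⟩, ?_, ?_⟩ <;> simp only at * <;> linarith

end VisitFrequency

section Gauss

lemma measurable_gauss : Measurable gauss :=
  Measurable.ite (measurableSet_singleton 0) measurable_const measurable_inv.fract

lemma measurable_qden (n : ℕ) : Measurable (qden n) := by
  induction n using Nat.twoStepInduction with
  | zero => exact measurable_const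
  | one => exact measurable_inv.floor
  | more n h1 h2 => exact ((measurable_gauss.iterate (n + 1)).inv.floor.mul h2).add h1

lemma measurable_Vpast (n : ℕ) : Measurable (Vpast n) := by
  unfold Vpast
  split_ifs
  · exact measurable_const
  · exact (measurable_from_top.comp (measurable_qden _)).div
      (measurable_from_top.comp (measurable_qden _))

lemma gauss_irrational_mem {x : ℝ} (hx : Irrational x) :
    Irrational (gauss x) ∧ gauss x ∈ Ioo 0 1 := by
  have h : Irrational (gauss x) := by
    rw [gauss, if_neg hx.ne_zero]
    exact hx.inv.sub_intCast _
  refine ⟨h, lt_of_le_of_ne ?_ h.ne_zero.symm, ?_⟩ <;> rw [gauss, if_neg hx.ne_zero]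
  exacts [Int.fract_nonneg _, Int.fract_lt_one _]

variable {x y : ℝ}

lemma gauss_iterate_irrational_mem (hx : Irrational x) (hx1 : x ∈ Ioo 0 1) (n : ℕ) :
    Irrational (gauss^[n] x) ∧ gauss^[n] x ∈ Ioo 0 1 := by
  induction n with
  | zero => exact ⟨hx, hx1⟩
  | succ n ih =>
    rw [Function.iterate_succ_apply']
    exact gauss_irrational_mem ih.1

lemma one_le_floor_inv_gauss_iterate (hx : Irrational x) (hx1 : x ∈ Ioo 0 1) (n : ℕ) :
    1 ≤ ⌊(gauss^[n] x)⁻¹⌋ := by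
  have h := (gauss_iterate_irrational_mem hx hx1 n).2
  rw [Int.le_floor, Int.cast_one]
  exact (one_le_inv₀ h.1).2 h.2.le

lemma qden_pos (hx : Irrational x) (hx1 : x ∈ Ioo 0 1) (n : ℕ) : 0 < qden n x := by
  induction n using Nat.twoStepInduction with
  | zero => exact zero_lt_one
  | one => exact zero_lt_one.trans_le (one_le_floor_inv_gauss_iterate hx hx1 0)
  | more n h1 h2 =>
    have := one_le_floor_inv_gauss_iterate hx hx1 (n + 1)
    rw [qden]
    positivity

lemma Vpast_nonneg (hx : Irrational x) (hx1 : x ∈ Ioo 0 1) (n : ℕ) : 0 ≤ Vpast n x := by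
  rw [Vpast]
  split_ifs
  · exact le_rfl
  · have h1 := qden_pos hx hx1 (n - 1)
    have h2 := qden_pos hx hx1 n
    positivity

lemma Vpast_succ (hx : Irrational x) (hx1 : x ∈ Ioo 0 1) (n : ℕ) :
    Vpast (n + 1) x = ((⌊(gauss^[n] x)⁻¹⌋ : ℝ) + Vpast n x)⁻¹ := by
  cases n with
  | zero => simp [Vpast, qden]
  | succ n =>
    have h1 : (0 : ℝ) < qden (n + 1) x := by exact_mod_cast qden_pos hx hx1 (n + 1)
    simp only [Vpast, Nat.add_eq_zero_iff, one_ne_zero, and_false, if_false, Nat.add_sub_cancel]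
    rw [qden, add_div' _ _ _ h1.ne', inv_div]
    push_cast
    rfl

lemma gaussExt_iterate_fst (p : ℝ × ℝ) (n : ℕ) : (gaussExt^[n] p).1 = gauss^[n] p.1 := by
  induction n with
  | zero => rfl
  | succ n ih => rw [Function.iterate_succ_apply', Function.iterate_succ_apply', gaussExt, ih]

lemma gaussExt_iterate_snd_succ (p : ℝ × ℝ) (n : ℕ) : (gaussExt^[n + 1] p).2 =
    ((⌊(gauss^[n] p.1)⁻¹⌋ : ℝ) + (gaussExt^[n] p).2)⁻¹ := by
  rw [Function.iterate_succ_apply', gaussExt, gaussExt_iterate_fst]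

lemma gaussExt_iterate_snd_nonneg (hx : Irrational x) (hx1 : x ∈ Ioo 0 1) (hy : 0 ≤ y) (n : ℕ) :
    0 ≤ (gaussExt^[n] (x, y)).2 := by
  induction n with
  | zero => exact hy
  | succ n ih =>
    have : (1 : ℝ) ≤ ⌊(gauss^[n] x)⁻¹⌋ := by
      exact_mod_cast one_le_floor_inv_gauss_iterate hx hx1 n
    rw [gaussExt_iterate_snd_succ]
    positivity

lemma abs_inv_add_sub_inv_add_le {m u v : ℝ} (hm : 1 ≤ m) (hu : 0 ≤ u) (hv : 0 ≤ v) :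
    |(m + u)⁻¹ - (m + v)⁻¹| ≤ |u - v| / (1 + |u - v|) := by
  have h1 : 0 < m + u := by linarith
  have h2 : 0 < m + v := by linarith
  have h3 : (m + u)⁻¹ - (m + v)⁻¹ = (v - u) / ((m + u) * (m + v)) := by
    field_simp
    ring
  rw [h3, abs_div, abs_sub_comm v u, abs_of_pos (mul_pos h1 h2)]
  gcongr
  have h4 : |u - v| ≤ u + v := abs_le.2 ⟨by linarith, by linarith⟩
  nlinarith [mul_nonneg hu hv]

/-- Fibres of the natural extension contract, so `Ĝⁿ(x, y)` is asymptotic to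
`Ĝⁿ(x, 0) = (Tₙ(x), Vₙ(x))`. -/
lemma abs_gaussExt_iterate_snd_sub_Vpast_le (hx : Irrational x) (hx1 : x ∈ Ioo 0 1)
    (hy : y ∈ Ico 0 1) (n : ℕ) :
    |(gaussExt^[n] (x, y)).2 - Vpast n x| ≤ 1 / ((n : ℝ) + 1) := by
  induction n with
  | zero => simpa [Vpast, abs_of_nonneg hy.1] using hy.2.le
  | succ n ih =>
    rw [gaussExt_iterate_snd_succ, Vpast_succ hx hx1]
    refine (abs_inv_add_sub_inv_add_le
      (by exact_mod_cast one_le_floor_inv_gauss_iterate hx hx1 n)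
      (gaussExt_iterate_snd_nonneg hx hx1 hy.1 n) (Vpast_nonneg hx hx1 n)).trans ?_
    have hd : 0 ≤ |(gaussExt^[n] (x, y)).2 - Vpast n x| := abs_nonneg _
    generalize |(gaussExt^[n] (x, y)).2 - Vpast n x| = d at ih hd
    have hn : (0 : ℝ) < n + 1 := by positivity
    rw [le_div_iff₀ hn] at ih
    rw [div_le_div_iff₀ (by positivity) (by positivity)]
    push_cast
    linarith

lemma measurable_visitFreq_gauss {R : Set (ℝ × ℝ)} (hR : MeasurableSet R) (n : ℕ) :
    Measurable fun x ↦ visitFreq (fun k ↦ (gauss^[k] x, Vpast k x)) R n :=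
  (Finset.measurable_sum _ fun k _ ↦ (measurable_one.indicator hR).comp
    ((measurable_gauss.iterate k).prodMk (measurable_Vpast k))).div_const _

lemma ae_tendsto_visitFreq_gauss {μ : Measure (ℝ × ℝ)} [IsProbabilityMeasure μ]
    (hconc : ∀ᵐ p ∂μ, p.1 ∈ Ico (0 : ℝ) 1 ∧ Irrational p.1 ∧ p.2 ∈ Ico (0 : ℝ) 1)
    (herg : Ergodic gaussExt μ)
    (hbd : ∀ a b c e : ℝ, μ (frontier (Ioo a b ×ˢ Ioo c e)) = 0) :
    ∀ᵐ p ∂μ, ∀ a b c e : ℝ, a < b → c < e →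
      Tendsto (visitFreq (fun k ↦ (gauss^[k] p.1, Vpast k p.1)) (Ioo a b ×ˢ Ioo c e))
        atTop (𝓝 (μ.real (Ioo a b ×ˢ Ioo c e))) := by
  have hbirk : ∀ᵐ p ∂μ, ∀ a b c e : ℚ,
      Tendsto (visitFreq (fun k ↦ gaussExt^[k] p) (Ioo (a : ℝ) b ×ˢ Ioo (c : ℝ) e))
        atTop (𝓝 (μ.real (Ioo (a : ℝ) b ×ˢ Ioo (c : ℝ) e))) := by
    simp_rw [ae_all_iff]
    intro a b c e
    have hR : MeasurableSet (Ioo (a : ℝ) b ×ˢ Ioo (c : ℝ) e) :=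
      measurableSet_Ioo.prod measurableSet_Ioo
    rw [← integral_indicator_one hR]
    exact ae_tendsto_birkhoffSum_div herg (measurable_one.indicator hR)
      ((integrable_const 1).indicator hR)
  filter_upwards [hconc, hbirk] with p hp hfreq a b c e hab hce
  have hp1 : p.1 ∈ Ioo 0 1 := ⟨lt_of_le_of_ne hp.1.1 hp.2.1.ne_zero.symm, hp.1.2⟩
  refine tendsto_visitFreq_rectangle (u := fun k ↦ (gaussExt^[k] p).2) ?_ ?_ hab hce (hbd a b c e)
  · exact squeeze_zero_norm (abs_gaussExt_iterate_snd_sub_Vpast_le hp.2.1 hp1 hp.2.2)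
      tendsto_one_div_add_atTop_nhds_zero_nat
  · simpa only [← gaussExt_iterate_fst] using hfreq

end Gauss

/-- equidistribution of the pairs `(T_k(x), V_k(x)) = Ĝ^k(x,0)` with
respect to a `Ĝ`-invariant ergodic measure `μ̂` on the natural extension of the Gauss
map which charges no boundary of a rectangle: for `μ̂∘p₁⁻¹`-a.e. `x` and every open
rectangle `(a,b) × (c,d)`, the asymptotic frequency of visits equals
`μ̂((a,b) × (c,d))`. -/
theorem statement18 (μhat : Measure (ℝ × ℝ)) [IsProbabilityMeasure μhat]
    (hconc : μhat {p : ℝ × ℝ |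
      p.1 ∈ Set.Ico (0 : ℝ) 1 ∧ Irrational p.1 ∧ p.2 ∈ Set.Ico (0 : ℝ) 1} = 1)
    (hinv : μhat.map gaussExt = μhat) (herg : Ergodic gaussExt μhat)
    (hbd : ∀ a b c e : ℝ, μhat (frontier (Set.Ioo a b ×ˢ Set.Ioo c e)) = 0) :
    ∀ᵐ x ∂(μhat.map Prod.fst), ∀ a b c e : ℝ, a < b → c < e →
      Tendsto (fun n : ℕ => (∑ k ∈ Finset.range n,
          if (gauss^[k] x, Vpast k x) ∈ Set.Ioo a b ×ˢ Set.Ioo c e then (1 : ℝ) else 0) / n)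
        atTop (𝓝 ((μhat (Set.Ioo a b ×ˢ Set.Ioo c e)).toReal)) := by
  have hconc' : ∀ᵐ p ∂μhat, p.1 ∈ Ico (0 : ℝ) 1 ∧ Irrational p.1 ∧ p.2 ∈ Ico (0 : ℝ) 1 := by
    have hirr : MeasurableSet {x : ℝ | Irrational x} :=
      (countable_range ((↑) : ℚ → ℝ)).measurableSet.compl
    refine (mem_ae_iff_prob_eq_one ?_).2 hconc
    exact (measurable_fst measurableSet_Ico).inter
      ((measurable_fst hirr).inter (measurable_snd measurableSet_Ico))
  have hrat : ∀ᵐ x ∂(μhat.map Prod.fst), ∀ a b c e : ℚ, a < b → c < e →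
      Tendsto (visitFreq (fun k ↦ (gauss^[k] x, Vpast k x)) (Ioo (a : ℝ) b ×ˢ Ioo (c : ℝ) e))
        atTop (𝓝 (μhat.real (Ioo (a : ℝ) b ×ˢ Ioo (c : ℝ) e))) := by
    simp_rw [ae_all_iff]
    intro a b c e hab hce
    rw [ae_map_iff measurable_fst.aemeasurable]
    · filter_upwards [ae_tendsto_visitFreq_gauss hconc' herg hbd] with p hp
      exact hp a b c e (by exact_mod_cast hab) (by exact_mod_cast hce)
    · exact measurableSet_tendsto _
        (measurable_visitFreq_gauss (measurableSet_Ioo.prod measurableSet_Ioo))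
  filter_upwards [hrat] with x hx a b c e hab hce
  have := tendsto_visitFreq_rectangle (μ := μhat) (u := fun k ↦ Vpast k x)
    (v := fun k ↦ Vpast k x) (t := fun k ↦ gauss^[k] x) (by simp) (fun a b c e ↦ ?_) hab hce
    (hbd a b c e)
  · refine this.congr fun n ↦ ?_
    simp only [visitFreq, indicator_apply, Pi.one_apply]
  · by_cases h : a < b ∧ c < e
    · exact hx a b c e h.1 h.2
    · have h0 : Ioo (a : ℝ) b ×ˢ Ioo (c : ℝ) e = ∅ := by
        rw [prod_eq_empty_iff, Ioo_eq_empty_iff, Ioo_eq_empty_iff]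
        exact_mod_cast not_and_or.1 h
      have h1 : visitFreq (fun k ↦ (gauss^[k] x, Vpast k x)) ∅ = 0 := by
        ext n
        simp [visitFreq]
      rw [h0, h1, measureReal_empty]
      exact tendsto_const_nhds

end Paper
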